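/- In the presented group ⟨x, y, z ∣ x² = y² = z² = 1, xyx = yxy, yzy = zyz, zxz = xzx⟩, one has (x·y·z)⁴ ≠ 1. (That is, the relation (XYZ)⁴ = I is not a consequence of the relations (7.1).) -/

import Mathlib

/-- The generator `x` as an element of the free group on three generators. -/
def xGen : FreeGroup (Fin 3) := FreeGroup.of 0

/-- The generator `y` as an element of the free group on three generators. -/
def yGen : FreeGroup (Fin 3) := FreeGroup.of 1

/-- The generator `z` as an element of the free group on three generators. -/
def zGen : FreeGroup (Fin 3) := FreeGroup.of 2

/-- Relators for the group ⟨x, y, z ∣ x² = y² = z² = 1,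
xyx = yxy, yzy = zyz, zxz = xzx⟩ (the relations (7.1) of the paper). -/
def rels3 : Set (FreeGroup (Fin 3)) :=
  {xGen ^ 2, yGen ^ 2, zGen ^ 2,
   (xGen * yGen * xGen) * (yGen * xGen * yGen)⁻¹,
   (yGen * zGen * yGen) * (zGen * yGen * zGen)⁻¹,
   (zGen * xGen * zGen) * (xGen * zGen * xGen)⁻¹}

/-- The image of `x` in the presented group. -/
def X : PresentedGroup rels3 := PresentedGroup.of 0

/-- The image of `y` in the presented group. -/
def Y : PresentedGroup rels3 := PresentedGroup.of 1

/-- The image of `z` in the presented group. -/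
def Z : PresentedGroup rels3 := PresentedGroup.of 2

/-- The images of the three generators under the action of the affine symmetric group of type `Ã₂`
on `ℤ / 9`: the `k`-th one swaps `i` and `i + 1` for every `i ≡ k` modulo `3`. -/
def affineReflection : Fin 3 → Equiv.Perm (Fin 9) :=
  ![Equiv.swap 0 1 * Equiv.swap 3 4 * Equiv.swap 6 7,
    Equiv.swap 1 2 * Equiv.swap 4 5 * Equiv.swap 7 8,
    Equiv.swap 2 3 * Equiv.swap 5 6 * Equiv.swap 8 0]

theorem lift_affineReflection_eq_one :
    ∀ r ∈ rels3, FreeGroup.lift affineReflection r = 1 := by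
  intro r hr
  rcases hr with rfl | rfl | rfl | rfl | rfl | rfl <;>
    simp only [xGen, yGen, zGen, map_mul, map_inv, map_pow, FreeGroup.lift_apply_of] <;>
    decide +kernel

/-- In ⟨x, y, z ∣ x² = y² = z² = 1, xyx = yxy, yzy = zyz, zxz = xzx⟩, the
relation `(xyz)⁴ = 1` does not hold: it is not a consequence of the
relations (7.1) of the paper. -/
theorem xyz_pow_four_ne_one : (X * Y * Z) ^ 4 ≠ 1 := by
  intro h
  have h' := congrArg (PresentedGroup.toGroup lift_affineReflection_eq_one) h
  simp only [X, Y, Z, map_mul, map_pow, map_one, PresentedGroup.toGroup.of] at h'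
  revert h'
  decide +kernel
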